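/- Let f be a C³ function on an open set U ⊆ ℝ⁴ such that x₁ ≠ x₂ and f₁₂ ≠ 0 everywhere on U, satisfying the heavenly equation (case A₀) (x₁−x₂)(x₃−x₄)f₁₂f₃₄ − (x₁−x₃)(x₂−x₄)f₁₃f₂₄ + (x₁−x₄)(x₂−x₃)f₁₄f₂₃ = 0 on U. Then for every λ ∈ ℝ the vector fields X₁(λ) = (f₂₄(x₂−x₄)/(f₁₂(x₁−x₂)))(x₁−λ)∂₁ − (f₁₄(x₁−x₄)/(f₁₂(x₁−x₂)))(x₂−λ)∂₂ + (x₄−λ)∂₄ and X₂(λ) = (f₂₃(x₂−x₃)/(f₁₂(x₁−x₂)))(x₁−λ)∂₁ − (f₁₃(x₁−x₃)/(f₁₂(x₁−x₂)))(x₂−λ)∂₂ + (x₃−λ)∂₃ commute on U: [X₁(λ),X₂(λ)] = 0. -/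

import Mathlib

open scoped BigOperators

/-- Partial derivative `∂f/∂x_j` on ℝ⁴ (coordinates `x₁,…,x₄` are indexed by `Fin 4`,
so `x_i` corresponds to index `i-1`). -/
noncomputable def pd (f : (Fin 4 → ℝ) → ℝ) (j : Fin 4) (x : Fin 4 → ℝ) : ℝ :=
  fderiv ℝ f x (Pi.single j 1)

/-- Second partial derivative `∂²f/∂x_i∂x_j` on ℝ⁴. -/
noncomputable def pd2 (f : (Fin 4 → ℝ) → ℝ) (i j : Fin 4) (x : Fin 4 → ℝ) : ℝ :=
  pd (pd f j) i x

/-- Lie bracket of vector fields on ℝ⁴: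
`[X,Y]^i = ∑_j (X^j ∂_j Y^i − Y^j ∂_j X^i)`. -/
noncomputable def lieB (X Y : (Fin 4 → ℝ) → (Fin 4 → ℝ)) (x : Fin 4 → ℝ) : Fin 4 → ℝ :=
  fun i => ∑ j, (X x j * pd (fun y => Y y i) j x - Y x j * pd (fun y => X y i) j x)

/-! ### Calculus rules for `pd` -/

section PartialDerivatives

variable {f g : (Fin 4 → ℝ) → ℝ} {x : Fin 4 → ℝ}

lemma pd_const (c : ℝ) (m : Fin 4) (x : Fin 4 → ℝ) : pd (fun _ => c) m x = 0 := by
  simp [pd]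

lemma pd_coord (i m : Fin 4) (x : Fin 4 → ℝ) :
    pd (fun y => y i) m x = (Pi.single m 1 : Fin 4 → ℝ) i := by
  simp [pd, (hasFDerivAt_apply (𝕜 := ℝ) i x).fderiv]

lemma pd_add (hf : DifferentiableAt ℝ f x) (hg : DifferentiableAt ℝ g x) (m : Fin 4) :
    pd (fun y => f y + g y) m x = pd f m x + pd g m x := by
  simp [pd, fderiv_fun_add hf hg]

lemma pd_sub (hf : DifferentiableAt ℝ f x) (hg : DifferentiableAt ℝ g x) (m : Fin 4) :
    pd (fun y => f y - g y) m x = pd f m x - pd g m x := by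
  simp [pd, fderiv_fun_sub hf hg]

lemma pd_coord_sub_const (i m : Fin 4) (c : ℝ) (x : Fin 4 → ℝ) :
    pd (fun y => y i - c) m x = (Pi.single m 1 : Fin 4 → ℝ) i := by
  rw [pd_sub (by fun_prop) (by fun_prop), pd_coord, pd_const, sub_zero]

lemma pd_neg (f : (Fin 4 → ℝ) → ℝ) (m : Fin 4) (x : Fin 4 → ℝ) :
    pd (fun y => -f y) m x = -pd f m x := by
  simp [pd]

lemma pd_mul (hf : DifferentiableAt ℝ f x) (hg : DifferentiableAt ℝ g x) (m : Fin 4) :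
    pd (fun y => f y * g y) m x = pd f m x * g x + f x * pd g m x := by
  simp [pd, fderiv_fun_mul hf hg]
  ring

lemma pd_div (hf : DifferentiableAt ℝ f x) (hg : DifferentiableAt ℝ g x) (h0 : g x ≠ 0)
    (m : Fin 4) :
    pd (fun y => f y / g y) m x = (pd f m x * g x - f x * pd g m x) / g x ^ 2 := by
  have hinv : HasFDerivAt (fun y => (g y)⁻¹) (-(g x ^ 2)⁻¹ • fderiv ℝ g x) x :=
    (hasDerivAt_inv h0).comp_hasFDerivAt x hg.hasFDerivAt
  simp only [div_eq_mul_inv]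
  rw [pd_mul hf hinv.differentiableAt, pd, pd, pd, hinv.fderiv]
  simp only [smul_apply, smul_eq_mul]
  field_simp
  ring

lemma pd_congr (h : f =ᶠ[nhds x] g) (m : Fin 4) : pd f m x = pd g m x := by
  rw [pd, pd, h.fderiv_eq]

lemma contDiffAt_pd {n k : WithTop ℕ∞} (hf : ContDiffAt ℝ n f x) (hk : k + 1 ≤ n) (j : Fin 4) :
    ContDiffAt ℝ k (pd f j) x :=
  (hf.fderiv_right hk).clm_apply contDiffAt_const

lemma pd2_comm (hf : ContDiffAt ℝ 2 f x) (i j : Fin 4) : pd2 f i j x = pd2 f j i x := by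
  have hd : DifferentiableAt ℝ (fderiv ℝ f) x :=
    (hf.fderiv_right (m := 1) (by norm_num)).differentiableAt (by norm_num)
  have key (i j : Fin 4) :
      pd2 f i j x = fderiv ℝ (fderiv ℝ f) x (Pi.single i 1) (Pi.single j 1) := by
    have h := hd.hasFDerivAt.clm_apply (hasFDerivAt_const (Pi.single j (1 : ℝ)) x)
    change fderiv ℝ (fun y => fderiv ℝ f y (Pi.single j 1)) x (Pi.single i 1) = _
    rw [h.fderiv]
    simp
  rw [key, key]
  exact (hf.isSymmSndFDerivAt (by simp)) _ _

lemma pd_pd2_swap_left (hf : ContDiffAt ℝ 3 f x) (k i j : Fin 4) :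
    pd (pd2 f i j) k x = pd (pd2 f k j) i x :=
  pd2_comm (contDiffAt_pd hf (by norm_num) j) k i

lemma pd_pd2_swap_right (hf : ContDiffAt ℝ 3 f x) (k i j : Fin 4) :
    pd (pd2 f i j) k x = pd (pd2 f j i) k x := by
  refine pd_congr ?_ k
  filter_upwards [(hf.of_le (by norm_num) : ContDiffAt ℝ 2 f x).eventually (by simp)] with y hy
  exact pd2_comm hy i j

lemma pd_pd2_rotate (hf : ContDiffAt ℝ 3 f x) (k i j : Fin 4) :
    pd (pd2 f i j) k x = pd (pd2 f j k) i x :=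
  (pd_pd2_swap_left hf k i j).trans (pd_pd2_swap_right hf i k j)

lemma differentiableAt_pd2 (hf : ContDiffAt ℝ 3 f x) (i j : Fin 4) :
    DifferentiableAt ℝ (pd2 f i j) x :=
  (contDiffAt_pd (k := 1) (contDiffAt_pd (k := 2) hf (by norm_num) j) (by norm_num) i
    ).differentiableAt (by norm_num)

/-- Partial derivatives of the coefficients of the Lax pair. -/
lemma pd_laxCoeff (hf : DifferentiableAt ℝ f x) (hg : DifferentiableAt ℝ g x)
    (hg0 : g x ≠ 0) (hx : x 0 ≠ x 1) (i j k m : Fin 4) (lam : ℝ) :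
    pd (fun y => f y * (y i - y j) / (g y * (y 0 - y 1)) * (y k - lam)) m x =
      (((pd f m x * (x i - x j)
          + f x * ((Pi.single m 1 : Fin 4 → ℝ) i - (Pi.single m 1 : Fin 4 → ℝ) j))
            * (g x * (x 0 - x 1))
        - f x * (x i - x j) * (pd g m x * (x 0 - x 1)
          + g x * ((Pi.single m 1 : Fin 4 → ℝ) 0 - (Pi.single m 1 : Fin 4 → ℝ) 1)))
        / (g x * (x 0 - x 1)) ^ 2) * (x k - lam)
      + f x * (x i - x j) / (g x * (x 0 - x 1)) * (Pi.single m 1 : Fin 4 → ℝ) k := by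
  have h0 : g x * (x 0 - x 1) ≠ 0 := mul_ne_zero hg0 (sub_ne_zero.2 hx)
  rw [pd_mul (by fun_prop (disch := exact h0)) (by fun_prop),
    pd_div (by fun_prop) (by fun_prop) h0, pd_mul hf (by fun_prop), pd_mul hg (by fun_prop),
    pd_sub (by fun_prop) (by fun_prop), pd_sub (by fun_prop) (by fun_prop),
    pd_sub (by fun_prop) (by fun_prop)]
  simp only [pd_coord, pd_const, sub_zero]

/-- Product rule for a summand of the heavenly equation. -/
lemma pd_heavenlyTerm (hf : DifferentiableAt ℝ f x) (hg : DifferentiableAt ℝ g x)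
    (i j k l m : Fin 4) :
    pd (fun y => (y i - y j) * (y k - y l) * f y * g y) m x =
      ((((Pi.single m 1 : Fin 4 → ℝ) i - (Pi.single m 1 : Fin 4 → ℝ) j) * (x k - x l)
        + (x i - x j) * ((Pi.single m 1 : Fin 4 → ℝ) k - (Pi.single m 1 : Fin 4 → ℝ) l)) * f x
        + (x i - x j) * (x k - x l) * pd f m x) * g x
      + (x i - x j) * (x k - x l) * f x * pd g m x := by
  rw [pd_mul (by fun_prop) hg, pd_mul (by fun_prop) hf, pd_mul (by fun_prop) (by fun_prop),
    pd_sub (by fun_prop) (by fun_prop), pd_sub (by fun_prop) (by fun_prop)]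
  simp only [pd_coord]

end PartialDerivatives

/-- If `f` is C³ on an open `U ⊆ ℝ⁴` with `x₁ ≠ x₂` and `f₁₂ ≠ 0`
everywhere on `U`, and satisfies the heavenly equation (case A₀), then for every `λ`
the Lax pair vector fields `X₁(λ), X₂(λ)` commute on `U`. -/
theorem heavenly_A0_lax_pair_commutes
    (U : Set (Fin 4 → ℝ)) (hU : IsOpen U)
    (f : (Fin 4 → ℝ) → ℝ) (hf : ContDiffOn ℝ 3 f U)
    (hx12 : ∀ x ∈ U, x 0 ≠ x 1)
    (hf12 : ∀ x ∈ U, pd2 f 0 1 x ≠ 0)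
    (heq : ∀ x ∈ U,
      (x 0 - x 1) * (x 2 - x 3) * pd2 f 0 1 x * pd2 f 2 3 x
      - (x 0 - x 2) * (x 1 - x 3) * pd2 f 0 2 x * pd2 f 1 3 x
      + (x 0 - x 3) * (x 1 - x 2) * pd2 f 0 3 x * pd2 f 1 2 x = 0) :
    ∀ lam : ℝ, ∀ x ∈ U,
      lieB
        (fun y =>
          ![pd2 f 1 3 y * (y 1 - y 3) / (pd2 f 0 1 y * (y 0 - y 1)) * (y 0 - lam),
            -(pd2 f 0 3 y * (y 0 - y 3) / (pd2 f 0 1 y * (y 0 - y 1))) * (y 1 - lam),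
            0,
            y 3 - lam])
        (fun y =>
          ![pd2 f 1 2 y * (y 1 - y 2) / (pd2 f 0 1 y * (y 0 - y 1)) * (y 0 - lam),
            -(pd2 f 0 2 y * (y 0 - y 2) / (pd2 f 0 1 y * (y 0 - y 1))) * (y 1 - lam),
            y 2 - lam,
            0])
        x = 0 := by
  intro lam x hx
  have hc : ContDiffAt ℝ 3 f x := hf.contDiffAt (hU.mem_nhds hx)
  have hd := differentiableAt_pd2 hc
  have hne := hf12 x hx
  have hxx := hx12 x hx
  have hxs : x 0 - x 1 ≠ 0 := sub_ne_zero.2 hxx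
  have hH := heq x hx
  have hdH (m : Fin 4) := (pd_congr (m := m) (x := x) (g := fun _ => (0 : ℝ))
    (Filter.eventually_of_mem (hU.mem_nhds hx) heq)).trans (pd_const 0 m x)
  have hterm (i j k l i' j' k' l' : Fin 4) : DifferentiableAt ℝ
      (fun y => (y i - y j) * (y k - y l) * pd2 f i' j' y * pd2 f k' l' y) x := by
    have h1 := hd i' j'
    have h2 := hd k' l'
    fun_prop
  simp only [pd_add ((hterm _ _ _ _ _ _ _ _).fun_sub (hterm _ _ _ _ _ _ _ _))
    (hterm _ _ _ _ _ _ _ _), pd_sub (hterm _ _ _ _ _ _ _ _) (hterm _ _ _ _ _ _ _ _),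
    pd_heavenlyTerm (hd _ _) (hd _ _)] at hdH
  have hH0 := hdH 0
  have hH1 := hdH 1
  have e1 : pd (pd2 f 0 2) 1 x = pd (pd2 f 1 2) 0 x := pd_pd2_swap_left hc _ _ _
  have e2 : pd (pd2 f 0 3) 1 x = pd (pd2 f 1 3) 0 x := pd_pd2_swap_left hc _ _ _
  have e3 : pd (pd2 f 0 1) 2 x = pd (pd2 f 1 2) 0 x := pd_pd2_rotate hc _ _ _
  have e4 : pd (pd2 f 0 1) 3 x = pd (pd2 f 1 3) 0 x := pd_pd2_rotate hc _ _ _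
  have e5 : pd (pd2 f 1 2) 3 x = pd (pd2 f 2 3) 1 x := pd_pd2_rotate hc _ _ _
  have e6 : pd (pd2 f 1 3) 2 x = pd (pd2 f 2 3) 1 x := pd_pd2_swap_left hc _ _ _
  have e7 : pd (pd2 f 0 2) 3 x = pd (pd2 f 2 3) 0 x := pd_pd2_rotate hc _ _ _
  have e8 : pd (pd2 f 0 3) 2 x = pd (pd2 f 2 3) 0 x := pd_pd2_swap_left hc _ _ _
  funext i
  fin_cases i
  · simp [lieB, Fin.sum_univ_four, pd_laxCoeff (hd _ _) (hd _ _) hne hxx, e1, e2, e3, e4,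
      e5, e6] at hH1 ⊢
    linear_combination (norm := skip)
      (x 0 - lam) * (x 1 - lam) / (pd2 f 0 1 x * (x 0 - x 1)) ^ 3 *
        ((pd (pd2 f 0 1) 1 x * (x 0 - x 1) - pd2 f 0 1 x) * hH
          - pd2 f 0 1 x * (x 0 - x 1) * hH1)
    field_simp
    ring
  · simp [lieB, Fin.sum_univ_four, pd_neg, pd_laxCoeff (hd _ _) (hd _ _) hne hxx, e1, e2, e3, e4,
      e7, e8] at hH0 ⊢
    linear_combination (norm := skip)
      -(x 0 - lam) * (x 1 - lam) / (pd2 f 0 1 x * (x 0 - x 1)) ^ 3 *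
        ((pd (pd2 f 0 1) 0 x * (x 0 - x 1) + pd2 f 0 1 x) * hH
          - pd2 f 0 1 x * (x 0 - x 1) * hH0)
    field_simp
    ring
  · simp [lieB, Fin.sum_univ_four, pd_const, pd_coord_sub_const]
  · simp [lieB, Fin.sum_univ_four, pd_const, pd_coord_sub_const]
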